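/- arXiv:1703.06377 — 2 statements merged into one kernel-verified Lean document; each statement's English description precedes it below -/
import Mathlib

section
/- Let k,ℓ ≥ 2 be integers with kℓ even, and let P_k □ P_ℓ denote the Cartesian (box) product of the path graph on k vertices {0,…,k−1} with the path graph on ℓ vertices {0,…,ℓ−1}. Then for every vertex (p,q) with 0 ≤ p < k, 0 ≤ q < ℓ, and p+q odd, the graph P_k □ P_ℓ has a hamiltonian path from the corner vertex (0,0) to (p,q). -/
open SimpleGraph

/-- The shift `i ↦ i + 1` as a homomorphism of path graphs. -/
def pathGraphSuccHom (n : ℕ) : pathGraph n →g pathGraph (n + 1) where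
  toFun := Fin.succ
  map_rel' := by
    intro a b h
    simp only [pathGraph_adj, Fin.val_succ] at h ⊢
    omega

/-- The reflection of a path graph. -/
def pathGraphRevHom (n : ℕ) : pathGraph n →g pathGraph n where
  toFun := Fin.rev
  map_rel' := by
    intro a b h
    simp only [pathGraph_adj, Fin.val_rev] at h ⊢
    omega

/-- Hamiltonian walks in two disjoint pieces covering a graph, joined by an edge. -/
theorem exists_isHamiltonian_append {U V W : Type*} [DecidableEq U] [DecidableEq V] [DecidableEq W]
    {G : SimpleGraph U} {H : SimpleGraph V} {K : SimpleGraph W} (f : G →g K) (g : H →g K)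
    (hf : Function.Injective f) (hg : Function.Injective g) (hfg : ∀ u v, f u ≠ g v)
    (hcover : ∀ x, (∃ u, f u = x) ∨ ∃ v, g v = x) {a b : U} {c d : V}
    {r : G.Walk a b} {w : H.Walk c d} (hr : r.IsHamiltonian) (hw : w.IsHamiltonian)
    (hadj : K.Adj (f b) (g c)) {x y : W} (hx : f a = x) (hy : g d = y) :
    ∃ v : K.Walk x y, v.IsHamiltonian := by
  subst hx hy
  refine ⟨(r.map f).append (Walk.cons hadj (w.map g)), fun z => ?_⟩
  rw [Walk.support_append, List.count_append, Walk.support_cons, List.tail_cons,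
    Walk.support_map, Walk.support_map]
  rcases hcover z with ⟨u, rfl⟩ | ⟨v, rfl⟩
  · rw [List.count_map_of_injective _ _ hf, hr u, List.count_eq_zero.2]
    simpa using fun v _ => (hfg u v).symm
  · rw [List.count_map_of_injective _ _ hg, hw v, List.count_eq_zero.2]
    simpa using fun u _ => hfg u v

/-- A path graph has a hamiltonian path between its two ends. -/
theorem exists_isHamiltonian_pathGraph (n : ℕ) :
    ∃ w : (pathGraph (n + 1)).Walk 0 (Fin.last n), w.IsHamiltonian := by
  induction n with
  | zero => exact ⟨Walk.nil, fun a => by fin_cases a; simp⟩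
  | succ n ih =>
    obtain ⟨w, hw⟩ := ih
    let f : (⊥ : SimpleGraph Unit) →g pathGraph (n + 2) := ⟨fun _ => 0, fun h => h.elim⟩
    have hr : (Walk.nil : (⊥ : SimpleGraph Unit).Walk () ()).IsHamiltonian := fun _ => by simp
    refine exists_isHamiltonian_append f (pathGraphSuccHom (n + 1)) (fun _ _ _ => rfl)
      (Fin.succ_injective _) (fun _ v => (Fin.succ_ne_zero v).symm) (fun x => ?_) hr hw ?_ rfl rfl
    · cases x using Fin.cases with
      | zero => exact Or.inl ⟨(), rfl⟩
      | succ a => exact Or.inr ⟨a, rfl⟩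
    · simp [pathGraph_adj, pathGraphSuccHom, f]

/-- The grid `P_{k+1} □ P_{l+1}` has a hamiltonian path from the corner `(0, 0)` to `(p, q)`. -/
def HasCornerPath (k l : ℕ) (p : Fin (k + 1)) (q : Fin (l + 1)) : Prop :=
  ∃ w : ((pathGraph (k + 1)).boxProd (pathGraph (l + 1))).Walk (0, 0) (p, q), w.IsHamiltonian

theorem HasCornerPath.swap {k l : ℕ} {p : Fin (k + 1)} {q : Fin (l + 1)}
    (h : HasCornerPath k l p q) : HasCornerPath l k q p := by
  obtain ⟨w, hw⟩ := h
  exact ⟨w.map (boxProdComm _ _).toHom, hw.map _ (boxProdComm _ _).bijective⟩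

/-- A path that first traverses row `0` and then continues in the reflected remaining grid. -/
theorem HasCornerPath.add_row {k l : ℕ} {p : Fin (k + 1)} {q : Fin (l + 1)}
    (h : HasCornerPath k l p q.rev) : HasCornerPath (k + 1) l p.succ q := by
  obtain ⟨w, hw⟩ := h
  obtain ⟨r, hr⟩ := exists_isHamiltonian_pathGraph l
  let f : (pathGraph (k + 1)).boxProd (pathGraph (l + 1)) →g
      (pathGraph (k + 2)).boxProd (pathGraph (l + 1)) :=
    { toFun := fun x => (x.1.succ, x.2.rev)
      map_rel' := by
        rintro ⟨a, b⟩ ⟨c, d⟩ h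
        simp only [boxProd_adj] at h ⊢
        rcases h with ⟨h, rfl⟩ | ⟨h, rfl⟩
        · exact Or.inl ⟨(pathGraphSuccHom _).map_rel h, rfl⟩
        · exact Or.inr ⟨(pathGraphRevHom _).map_rel h, rfl⟩ }
  have hf : Function.Injective f := by
    rintro ⟨a, b⟩ ⟨c, d⟩ h
    simpa [f] using h
  refine exists_isHamiltonian_append
    (boxProdRight (pathGraph (k + 2)) (pathGraph (l + 1)) 0).toHom f
    (RelEmbedding.injective _) hf ?_ ?_ hr hw ?_ rfl ?_
  · rintro u ⟨a, b⟩ h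
    exact Fin.succ_ne_zero a (congrArg Prod.fst h).symm
  · rintro ⟨a, b⟩
    cases a using Fin.cases with
    | zero => exact Or.inl ⟨b, rfl⟩
    | succ a => exact Or.inr ⟨(a, b.rev), by simp [f]⟩
  · simp [f, boxProd_adj, pathGraph_adj]
  · simp [f]

/-- Corner hamiltonian paths in a grid of either parity: the end must have the right colour,
differ from the start, and lie at the far end when the grid is a single row or column. -/
theorem hasCornerPath_of_parity (k l : ℕ) (p : Fin (k + 1)) (q : Fin (l + 1))
    (hpar : (p + q : ℕ) % 2 = (k * l + k + l) % 2)
    (hne : (p : ℕ) = 0 → (q : ℕ) = 0 → k = 0 ∧ l = 0)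
    (hk : k = 0 → (q : ℕ) = l) (hl : l = 0 → (p : ℕ) = k) : HasCornerPath k l p q := by
  induction hn : k + l using Nat.strong_induction_on generalizing k l with
  | _ n ih =>
  have row {k l : ℕ} (hkl : k + 1 + l = n) (p : Fin (k + 2)) (q : Fin (l + 1))
      (hpar : (p + q : ℕ) % 2 = ((k + 1) * l + (k + 1) + l) % 2) (hp : 1 ≤ (p : ℕ))
      (hne : (p : ℕ) = 1 → (q : ℕ) = l → k = 0 ∧ l = 0) (hk : k = 0 → (q : ℕ) = 0)
      (hl : l = 0 → (p : ℕ) = k + 1) : HasCornerPath (k + 1) l p q := by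
    obtain ⟨p, rfl⟩ := Fin.exists_succ_eq.2 (show p ≠ 0 by rintro rfl; simp at hp)
    rw [Nat.succ_mul] at hpar
    simp only [Fin.val_succ] at hpar hne hl
    have hrev := Fin.val_rev q
    exact (ih (k + l) (by omega) k l p q.rev (by omega) (by omega) (by omega) (by omega)
      rfl).add_row
  have hcases : (1 ≤ k ∧ 1 ≤ (p : ℕ) ∧ ((p : ℕ) = 1 → (q : ℕ) = l → k = 1 ∧ l = 0) ∧
      (k = 1 → (q : ℕ) = 0)) ∨ (1 ≤ l ∧ 1 ≤ (q : ℕ) ∧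
      ((q : ℕ) = 1 → (p : ℕ) = k → l = 1 ∧ k = 0) ∧ (l = 1 → (p : ℕ) = 0)) ∨
      (k = 0 ∧ l = 0) := by
    have hmul : k * l % 2 = (k % 2) * (l % 2) % 2 := Nat.mul_mod k l 2
    have hp := p.isLt
    have hq := q.isLt
    rcases Nat.mod_two_eq_zero_or_one k with h | h <;>
      rcases Nat.mod_two_eq_zero_or_one l with h' | h' <;>
      rw [h, h'] at hmul <;> omega
  rcases hcases with ⟨h1, hp, hb, he⟩ | ⟨h1, hq, hb, he⟩ | ⟨rfl, rfl⟩
  · obtain ⟨k, rfl⟩ := Nat.exists_eq_add_of_le' h1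
    exact row hn p q hpar hp (by omega) (by omega) hl
  · obtain ⟨l, rfl⟩ := Nat.exists_eq_add_of_le' h1
    rw [Nat.mul_comm] at hpar
    exact (row (by omega) q p (by omega) hq (by omega) (by omega) hk).swap
  · obtain rfl : p = 0 := Fin.eq_zero p
    obtain rfl : q = 0 := Fin.eq_zero q
    refine ⟨Walk.nil, fun a => ?_⟩
    rw [show a = (0, 0) from Prod.ext (Fin.eq_zero _) (Fin.eq_zero _)]
    simp

/-- If `k, ℓ ≥ 2` and `k * ℓ` is even, then the box product `P_k □ P_ℓ` of path graphs
has a hamiltonian path from the corner `(0, 0)` to any vertex `(p, q)` with `p + q` odd. -/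
theorem stmt5 (k l : ℕ) (hk : 2 ≤ k) (hl : 2 ≤ l) (hkl : Even (k * l))
    (p q : ℕ) (hp : p < k) (hq : q < l) (hodd : Odd (p + q)) :
    ∃ w : ((pathGraph k).boxProd (pathGraph l)).Walk
        (⟨0, by omega⟩, ⟨0, by omega⟩) (⟨p, hp⟩, ⟨q, hq⟩),
      w.IsHamiltonian := by
  obtain ⟨k, rfl⟩ := Nat.exists_eq_succ_of_ne_zero (by omega : k ≠ 0)
  obtain ⟨l, rfl⟩ := Nat.exists_eq_succ_of_ne_zero (by omega : l ≠ 0)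
  refine hasCornerPath_of_parity k l ⟨p, hp⟩ ⟨q, hq⟩ ?_ ?_ ?_ ?_ <;> dsimp only
  · rw [Nat.even_iff, Nat.succ_mul_succ] at hkl
    rw [Nat.odd_iff] at hodd
    grind
  all_goals grind
end

section
/- Let p be an odd prime, let G be a finite group whose commutator subgroup G' = [G,G] has order 2p, and let Z_p be the unique subgroup of order p of G' (which is cyclic). Let S be an irredundant generating set of G and let S₀ be a proper subset of S such that Z_p ⊆ ⟨S₀⟩. Then the image of S₀ in G/G' does not generate G/G'. -/
/-- A subset `T` of a group `H` is an irredundant generating set if `T` generates `H`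
but no proper subset of `T` generates `H`. -/
def IsIrredundantGenSet {H : Type*} [Group H] (T : Set H) : Prop :=
  Subgroup.closure T = ⊤ ∧ ∀ T' ⊂ T, Subgroup.closure T' ≠ ⊤

/-- A subgroup that covers the group modulo the center contains the commutator subgroup. -/
theorem commutator_le_of_sup_center_eq_top {Q : Type*} [Group Q] {K : Subgroup Q}
    (h : K ⊔ Subgroup.center Q = ⊤) : commutator Q ≤ K := by
  rw [commutator_def, Subgroup.commutator_le]
  intro a _ b _
  obtain ⟨x, hx, z, hz, rfl⟩ := Subgroup.mem_sup_of_normal_right.1 (h ▸ Subgroup.mem_top a)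
  obtain ⟨y, hy, w, hw, rfl⟩ := Subgroup.mem_sup_of_normal_right.1 (h ▸ Subgroup.mem_top b)
  rw [Subgroup.mem_center_iff] at hz hw
  have key : x * z * (y * w) * (x * z)⁻¹ * (y * w)⁻¹ = x * y * x⁻¹ * y⁻¹ := by
    have h₁ : x * z * (y * w) = x * y * (z * w) := by
      simp only [mul_assoc, ← mul_assoc z y w, ← hz y]
    have h₂ : y * w * (x * z) = y * x * (z * w) := by
      simp only [mul_assoc, ← mul_assoc w x z, ← hw x, ← hw z]
    rw [mul_assoc, ← mul_inv_rev, h₁, h₂]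
    group
  rw [commutatorElement_def, key]
  exact K.mul_mem (K.mul_mem (K.mul_mem hx hy) (K.inv_mem hx)) (K.inv_mem hy)

/-- A normal subgroup of order two is central. -/
theorem Subgroup.Normal.le_center_of_card_eq_two {Q : Type*} [Group Q] {N : Subgroup Q}
    (hN : N.Normal) (hcard : Nat.card N = 2) : N ≤ Subgroup.center Q := by
  obtain ⟨u, -, hu⟩ := (Nat.card_eq_two_iff' (1 : N)).1 hcard
  intro z hz
  rw [Subgroup.mem_center_iff]
  intro g
  by_cases hz1 : z = 1
  · simp [hz1]
  have h₁ := hu ⟨z, hz⟩ (by simpa [Subtype.ext_iff] using hz1)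
  have h₂ := hu ⟨g * z * g⁻¹, hN.conj_mem z hz g⟩ (by simpa [Subtype.ext_iff] using hz1)
  have h₃ : g * z * g⁻¹ = z := congrArg Subtype.val (h₂.trans h₁.symm)
  rwa [mul_inv_eq_iff_eq_mul] at h₃

/-- A subgroup of odd order and index two in a normal subgroup is normal in the whole group. -/
theorem Subgroup.normal_of_relIndex_eq_two_of_odd_card {G : Type*} [Group G] {N P : Subgroup G}
    (hN : N.Normal) (hle : P ≤ N) (hindex : P.relIndex N = 2) (hodd : Odd (Nat.card P)) :
    P.Normal := by
  refine ⟨fun x hx g => ?_⟩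
  set y := g * x * g⁻¹ with hy
  have hyN : y ∈ N := hN.conj_mem x (hle hx) g
  have hypow : y ^ Nat.card P = 1 := by
    have : x ^ Nat.card P = 1 := congrArg Subtype.val (pow_card_eq_one' (x := (⟨x, hx⟩ : P)))
    rw [hy, conj_pow, this, mul_one, mul_inv_cancel]
  have hsq : y * y ∈ P := by
    simpa [Subgroup.mem_subgroupOf] using
      Subgroup.mul_self_mem_of_index_two (H := P.subgroupOf N) hindex ⟨y, hyN⟩
  obtain ⟨k, hk⟩ := hodd
  have : (y * y) ^ (k + 1) = y := by
    rw [← sq, ← pow_mul, show 2 * (k + 1) = Nat.card P + 1 by omega, pow_succ, hypow, one_mul]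
  exact this ▸ P.pow_mem hsq _

/-- Let `p` be an odd prime and `G` a finite group whose commutator subgroup `G'` has
order `2p`, with `Z_p` its unique subgroup of order `p`.  If `S` is an irredundant
generating set of `G` and `S₀ ⊊ S` with `Z_p ⊆ ⟨S₀⟩`, then the image of `S₀` in `G/G'`
does not generate `G/G'`. -/
theorem stmt14 {G : Type*} [Group G] [Fintype G]
    (p : ℕ) (hp : p.Prime) (hodd : Odd p)
    (hcomm : Nat.card (commutator G) = 2 * p)
    (Zp : Subgroup G) (hZple : Zp ≤ commutator G) (hZpcard : Nat.card Zp = p)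
    (S : Set G) (hirr : IsIrredundantGenSet S)
    (S₀ : Set G) (hS₀ : S₀ ⊂ S) (hZp : Zp ≤ Subgroup.closure S₀) :
    Subgroup.closure
      ((QuotientGroup.mk '' S₀ : Set (G ⧸ commutator G))) ≠ ⊤ := by
  intro htop
  set H := Subgroup.closure S₀ with hH
  have hne : H ≠ ⊤ := hirr.2 S₀ hS₀
  have hindex : Zp.relIndex (commutator G) = 2 := by
    have h := Subgroup.card_mul_index (Zp.subgroupOf (commutator G))
    rw [Nat.card_congr (Subgroup.subgroupOfEquivOfLe hZple).toEquiv, hZpcard, hcomm,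
      mul_comm 2] at h
    exact Nat.eq_of_mul_eq_mul_left hp.pos h
  have hnormal : Zp.Normal := Subgroup.normal_of_relIndex_eq_two_of_odd_card
    inferInstance hZple hindex (hZpcard ▸ hodd)
  have hmapcomm : (commutator G).map (QuotientGroup.mk' Zp) = commutator (G ⧸ Zp) := by
    rw [commutator_def, commutator_def, Subgroup.map_commutator,
      Subgroup.map_top_of_surjective _ (QuotientGroup.mk'_surjective Zp)]
  have hcard : Nat.card (commutator (G ⧸ Zp)) = 2 := by
    rw [← hmapcomm, ← hindex, ← Subgroup.relIndex_ker, QuotientGroup.ker_mk']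
  have hcover : H ⊔ commutator G = ⊤ := by
    have h : H.map (QuotientGroup.mk' (commutator G)) = ⊤ := by
      rw [hH, MonoidHom.map_closure]
      exact htop
    rw [← QuotientGroup.ker_mk' (commutator G), ← Subgroup.comap_map_eq, h, Subgroup.comap_top]
  have hcenter : H.map (QuotientGroup.mk' Zp) ⊔ Subgroup.center (G ⧸ Zp) = ⊤ := by
    have hle : commutator (G ⧸ Zp) ≤ Subgroup.center (G ⧸ Zp) :=
      Subgroup.Normal.le_center_of_card_eq_two inferInstance hcard
    refine top_le_iff.1 (le_trans (le_of_eq ?_) (sup_le_sup_left hle _))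
    rw [← hmapcomm, ← Subgroup.map_sup, hcover,
      Subgroup.map_top_of_surjective _ (QuotientGroup.mk'_surjective Zp)]
  have hle : commutator G ≤ H := by
    have h := commutator_le_of_sup_center_eq_top hcenter
    rw [← hmapcomm, Subgroup.map_le_iff_le_comap, Subgroup.comap_map_eq,
      QuotientGroup.ker_mk', sup_eq_left.2 hZp] at h
    exact h
  exact hne (by rwa [sup_eq_left.2 hle] at hcover)
end
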